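/- With the parameters c_k = (N_0+k)^{-1}, N_k = ⌈(N_0+k)^{t/2}⌉ (N_0 large enough that c_k N_k < 1 for all k), δ_k = ∏ c_i, define F_k = ∑_{i=1}^k δ_i[N_i] + [0,δ_k] and F = ⋂_k F_k. Then the Hausdorff dimension and the box dimension of F are both equal to t/2. -/

import Mathlib

open Filter Set

/-- The least number of sets of diameter at most `δ` needed to cover `F`. -/
noncomputable def coverN {X : Type*} [PseudoMetricSpace X] (F : Set X) (δ : ℝ) : ℕ :=
  sInf {n : ℕ | ∃ U : Fin n → Set X,
    (∀ i, EMetric.diam (U i) ≤ ENNReal.ofReal δ) ∧ F ⊆ ⋃ i, U i}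

/-- Upper box (Minkowski) dimension. -/
noncomputable def upperBoxDim {X : Type*} [PseudoMetricSpace X] (F : Set X) : ℝ :=
  Filter.limsup (fun δ : ℝ => Real.log (coverN F δ) / -Real.log δ)
    (nhdsWithin 0 (Set.Ioi 0))

/-- Lower box (Minkowski) dimension. -/
noncomputable def lowerBoxDim {X : Type*} [PseudoMetricSpace X] (F : Set X) : ℝ :=
  Filter.liminf (fun δ : ℝ => Real.log (coverN F δ) / -Real.log δ)
    (nhdsWithin 0 (Set.Ioi 0))

/-- `N_k = ⌈(N₀+k)^{t/2}⌉`. -/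
noncomputable def CN (N₀ : ℕ) (t : ℝ) (k : ℕ) : ℕ := ⌈((N₀ : ℝ) + k) ^ (t / 2)⌉₊

/-- `δ_k = ∏_{i=1}^k (N₀+i)⁻¹`. -/
noncomputable def Cδ (N₀ : ℕ) (k : ℕ) : ℝ := ∏ i ∈ Finset.Icc 1 k, ((N₀ : ℝ) + i)⁻¹

/-- The level-`k` set `F_k = ∑_{i=1}^k δ_i [N_i] + [0, δ_k]`. -/
noncomputable def CFlevel (N₀ : ℕ) (t : ℝ) (k : ℕ) : Set ℝ :=
  {x | ∃ f : ℕ → ℕ, (∀ i ∈ Finset.Icc 1 k, f i < CN N₀ t i) ∧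
    ∃ r ∈ Set.Icc (0:ℝ) (Cδ N₀ k), x = (∑ i ∈ Finset.Icc 1 k, Cδ N₀ i * f i) + r}

/-- The Cantor set `F = ⋂ₖ F_k`. -/
noncomputable def CF (N₀ : ℕ) (t : ℝ) : Set ℝ := ⋂ k, CFlevel N₀ t k

open MeasureTheory

/-- `P_k = ∏ N_i`. -/
noncomputable def CP (N₀ : ℕ) (t : ℝ) (k : ℕ) : ℕ := ∏ i ∈ Finset.Icc 1 k, CN N₀ t i

/-- mixed radix digits of `y`. -/
noncomputable def Cdig (N₀ : ℕ) (t : ℝ) (y : ℝ) (i : ℕ) : ℕ := ⌊y * CP N₀ t i⌋₊ % CN N₀ t i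

/-- partial sums. -/
noncomputable def Chp (N₀ : ℕ) (t : ℝ) (y : ℝ) (k : ℕ) : ℝ :=
  ∑ i ∈ Finset.Icc 1 k, Cδ N₀ i * Cdig N₀ t y i

/-- the inverse of the Cantor function. -/
noncomputable def Ch (N₀ : ℕ) (t : ℝ) (y : ℝ) : ℝ := ⨆ k, Chp N₀ t y k

lemma CP_zero (N₀ : ℕ) (t : ℝ) : CP N₀ t 0 = 1 := by simp [CP]
lemma CP_succ (N₀ : ℕ) (t : ℝ) (k : ℕ) : CP N₀ t (k+1) = CP N₀ t k * CN N₀ t (k+1) := by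
  unfold CP; rw [Finset.prod_Icc_succ_top (by omega)]
lemma Cδ_zero (N₀ : ℕ) : Cδ N₀ 0 = 1 := by simp [Cδ]
lemma Cδ_succ (N₀ : ℕ) (k : ℕ) : Cδ N₀ (k+1) = Cδ N₀ k * ((N₀:ℝ) + (k+1:ℕ))⁻¹ := by
  unfold Cδ; rw [Finset.prod_Icc_succ_top (by omega)]
lemma Chp_succ (N₀ : ℕ) (t y : ℝ) (k : ℕ) :
    Chp N₀ t y (k+1) = Chp N₀ t y k + Cδ N₀ (k+1) * Cdig N₀ t y (k+1) := by
  unfold Chp; rw [Finset.sum_Icc_succ_top (by omega)]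

lemma Cδ_pos (N₀ : ℕ) (k : ℕ) : 0 < Cδ N₀ k := by
  induction k with
  | zero => simp [Cδ_zero]
  | succ k ih => rw [Cδ_succ]; positivity

lemma Cδ_succ_mul (N₀ : ℕ) (k : ℕ) : Cδ N₀ (k+1) * ((N₀:ℝ) + (k+1:ℕ)) = Cδ N₀ k := by
  rw [Cδ_succ, mul_assoc, inv_mul_cancel₀ (by positivity), mul_one]


lemma Cδ_half {N₀ : ℕ} {t : ℝ} (hs : ∀ k, 1 ≤ k → CN N₀ t k + 1 ≤ N₀ + k)
    (h2 : ∀ k, 1 ≤ k → 2 ≤ CN N₀ t k) (k : ℕ) : Cδ N₀ (k+1) ≤ Cδ N₀ k / 2 := by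
  rw [← Cδ_succ_mul N₀ k]
  have h1 := hs (k+1) (by omega)
  have h3 := h2 (k+1) (by omega)
  have : (2:ℝ) ≤ (N₀:ℝ) + (k+1:ℕ) := by exact_mod_cast (by omega : 2 ≤ N₀ + (k+1))
  nlinarith [Cδ_pos N₀ (k+1)]

lemma Cδ_anti {N₀ : ℕ} {t : ℝ} (hs : ∀ k, 1 ≤ k → CN N₀ t k + 1 ≤ N₀ + k)
    (h2 : ∀ k, 1 ≤ k → 2 ≤ CN N₀ t k) : Antitone (Cδ N₀) := antitone_nat_of_succ_le fun k => by
  linarith [Cδ_half hs h2 k, Cδ_pos N₀ k]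

lemma Cδ_tendsto {N₀ : ℕ} {t : ℝ} (hs : ∀ k, 1 ≤ k → CN N₀ t k + 1 ≤ N₀ + k)
    (h2 : ∀ k, 1 ≤ k → 2 ≤ CN N₀ t k) : Tendsto (Cδ N₀) atTop (nhds 0) := by
  have : ∀ k, Cδ N₀ k ≤ (1/2:ℝ)^k := by
    intro k
    induction k with
    | zero => simp [Cδ_zero]
    | succ k ih => rw [pow_succ]; linarith [Cδ_half hs h2 k]
  exact squeeze_zero (fun k => (Cδ_pos N₀ k).le) this
    (tendsto_pow_atTop_nhds_zero_of_lt_one (by norm_num) (by norm_num))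

lemma CP_ge {N₀ : ℕ} {t : ℝ} (hs : ∀ k, 1 ≤ k → CN N₀ t k + 1 ≤ N₀ + k)
    (h2 : ∀ k, 1 ≤ k → 2 ≤ CN N₀ t k) (k : ℕ) : 2^k ≤ CP N₀ t k := by
  induction k with
  | zero => simp [CP_zero]
  | succ k ih => rw [CP_succ, pow_succ]; exact Nat.mul_le_mul ih (h2 _ (by omega))

lemma CP_pos {N₀ : ℕ} {t : ℝ} (hs : ∀ k, 1 ≤ k → CN N₀ t k + 1 ≤ N₀ + k)
    (h2 : ∀ k, 1 ≤ k → 2 ≤ CN N₀ t k) (k : ℕ) : 0 < CP N₀ t k := lt_of_lt_of_le (by positivity) (CP_ge hs h2 k)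

lemma Cdig_lt {N₀ : ℕ} {t : ℝ} (hs : ∀ k, 1 ≤ k → CN N₀ t k + 1 ≤ N₀ + k)
    (h2 : ∀ k, 1 ≤ k → 2 ≤ CN N₀ t k) (y : ℝ) (i : ℕ) (hi : 1 ≤ i) : Cdig N₀ t y i < CN N₀ t i :=
  Nat.mod_lt _ (by have := h2 i hi; omega)

lemma Chp_step {N₀ : ℕ} {t : ℝ} (hs : ∀ k, 1 ≤ k → CN N₀ t k + 1 ≤ N₀ + k)
    (h2 : ∀ k, 1 ≤ k → 2 ≤ CN N₀ t k) (y : ℝ) (k : ℕ) :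
    Chp N₀ t y (k+1) + 2 * Cδ N₀ (k+1) ≤ Chp N₀ t y k + Cδ N₀ k := by
  rw [Chp_succ, ← Cδ_succ_mul N₀ k]
  have h1 := hs (k+1) (by omega)
  have h3 := Cdig_lt hs h2 y (k+1) (by omega)
  have : (Cdig N₀ t y (k+1):ℝ) + 2 ≤ (N₀:ℝ) + (k+1:ℕ) := by
    exact_mod_cast (by omega : Cdig N₀ t y (k+1) + 2 ≤ N₀ + (k+1))
  nlinarith [Cδ_pos N₀ (k+1)]

lemma Ch_mem {N₀ : ℕ} {t : ℝ} (hs : ∀ k, 1 ≤ k → CN N₀ t k + 1 ≤ N₀ + k)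
    (h2 : ∀ k, 1 ≤ k → 2 ≤ CN N₀ t k) (y : ℝ) (k : ℕ) : Chp N₀ t y k ≤ Ch N₀ t y ∧ Ch N₀ t y ≤ Chp N₀ t y k + Cδ N₀ k := by
  have := Monotone.ciSup_mem_iInter_Icc_of_antitone (f := Chp N₀ t y)
    (g := fun k => Chp N₀ t y k + Cδ N₀ k)
    (monotone_nat_of_le_succ fun k => by
      rw [Chp_succ]
      have := Cδ_pos N₀ (k+1)
      have : (0:ℝ) ≤ Cδ N₀ (k+1) * Cdig N₀ t y (k+1) := by positivity
      linarith)
    (antitone_nat_of_succ_le fun k => by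
      linarith [Chp_step hs h2 y k, Cδ_pos N₀ (k+1)])
    (fun k => by simpa using (Cδ_pos N₀ k).le)
  exact Set.mem_iInter.1 this k

lemma Ch_mem_CF {N₀ : ℕ} {t : ℝ} (hs : ∀ k, 1 ≤ k → CN N₀ t k + 1 ≤ N₀ + k)
    (h2 : ∀ k, 1 ≤ k → 2 ≤ CN N₀ t k) (y : ℝ) : Ch N₀ t y ∈ CF N₀ t := by
  refine Set.mem_iInter.2 fun k => ⟨Cdig N₀ t y, fun i hi => Cdig_lt hs h2 y i (Finset.mem_Icc.1 hi).1,
    Ch N₀ t y - Chp N₀ t y k, ?_, ?_⟩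
  · have := Ch_mem hs h2 y k
    constructor <;> linarith
  · unfold Chp; ring

lemma Cfloor_div {N₀ : ℕ} {t : ℝ} (hs : ∀ k, 1 ≤ k → CN N₀ t k + 1 ≤ N₀ + k)
    (h2 : ∀ k, 1 ≤ k → 2 ≤ CN N₀ t k) (y : ℝ) (m : ℕ) :
    ⌊y * CP N₀ t (m+1)⌋₊ / CN N₀ t (m+1) = ⌊y * CP N₀ t m⌋₊ := by
  rw [← Nat.floor_div_natCast, CP_succ]
  have := h2 (m+1) (by omega)
  have : (CN N₀ t (m+1) : ℝ) ≠ 0 := by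
    exact_mod_cast (by omega : CN N₀ t (m+1) ≠ 0)
  congr 1
  push_cast
  field_simp

lemma Ch_expand {N₀ : ℕ} {t : ℝ} (hs : ∀ k, 1 ≤ k → CN N₀ t k + 1 ≤ N₀ + k)
    (h2 : ∀ k, 1 ≤ k → 2 ≤ CN N₀ t k) {y y' : ℝ} (hy : 0 ≤ y) (hyy : y < y') (hy' : y' < 1) :
    ∃ m, (y' - y) * CP N₀ t m ≤ 1 ∧ Cδ N₀ (m+2) ≤ Ch N₀ t y' - Ch N₀ t y := by
  classical
  have hex : ∃ k, ⌊y * CP N₀ t k⌋₊ ≠ ⌊y' * CP N₀ t k⌋₊ := by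
    obtain ⟨k, hk⟩ := pow_unbounded_of_one_lt (1/(y'-y)) (one_lt_two (α := ℝ))
    refine ⟨k, fun h => ?_⟩
    have h1 : ((2^k : ℕ):ℝ) ≤ CP N₀ t k := by exact_mod_cast CP_ge hs h2 k
    push_cast at h1
    have h3 : 1 < (y'-y) * CP N₀ t k := by
      rw [div_lt_iff₀ (by linarith)] at hk
      nlinarith
    have h4 := Nat.floor_le (a := y * CP N₀ t k) (by positivity)
    have h5 := Nat.lt_floor_add_one (y' * CP N₀ t k)
    rw [← h] at h5
    linarith
  obtain ⟨m, hm⟩ : ∃ m, Nat.find hex = m + 1 := by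
    refine Nat.exists_eq_succ_of_ne_zero fun h => ?_
    have := Nat.find_spec hex
    rw [h] at this
    apply this
    simp only [CP_zero, Nat.cast_one, mul_one]
    rw [Nat.floor_eq_zero.2 (by linarith), Nat.floor_eq_zero.2 hy']
  have hne := Nat.find_spec hex
  rw [hm] at hne
  have heq : ∀ i, i ≤ m → ⌊y * CP N₀ t i⌋₊ = ⌊y' * CP N₀ t i⌋₊ := by
    intro i hi
    by_contra h
    have := Nat.find_min' hex h
    omega
  have hlt : ⌊y * CP N₀ t (m+1)⌋₊ < ⌊y' * CP N₀ t (m+1)⌋₊ :=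
    lt_of_le_of_ne (Nat.floor_mono (by gcongr)) hne
  have hdig : Cdig N₀ t y (m+1) < Cdig N₀ t y' (m+1) := by
    have e1 := Cfloor_div hs h2 y m
    have e2 := Cfloor_div hs h2 y' m
    have e3 := Nat.div_add_mod ⌊y * CP N₀ t (m+1)⌋₊ (CN N₀ t (m+1))
    have e4 := Nat.div_add_mod ⌊y' * CP N₀ t (m+1)⌋₊ (CN N₀ t (m+1))
    rw [e1] at e3
    rw [e2, ← heq m le_rfl] at e4
    unfold Cdig
    omega
  have hp : Chp N₀ t y m = Chp N₀ t y' m := by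
    unfold Chp
    refine Finset.sum_congr rfl fun i hi => ?_
    unfold Cdig
    rw [heq i (Finset.mem_Icc.1 hi).2]
  refine ⟨m, ?_, ?_⟩
  · have h4 := Nat.floor_le (a := y * CP N₀ t m) (by positivity)
    have h5 := Nat.lt_floor_add_one (y' * CP N₀ t m)
    rw [← heq m le_rfl] at h5
    linarith
  · have a1 := (Ch_mem hs h2 y (m+2)).2
    have a2 := Chp_step hs h2 y (m+1)
    have a3 := (Ch_mem hs h2 y' (m+1)).1
    rw [Chp_succ] at a3
    have a4 := Chp_succ N₀ t y m
    have : (Cdig N₀ t y (m+1) : ℝ) + 1 ≤ Cdig N₀ t y' (m+1) := by exact_mod_cast hdig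
    have := mul_le_mul_of_nonneg_left this (Cδ_pos N₀ (m+1)).le
    rw [show m+2 = m+1+1 from rfl] at *
    linarith

lemma Ch_holder {N₀ : ℕ} {t : ℝ} (hs : ∀ k, 1 ≤ k → CN N₀ t k + 1 ≤ N₀ + k)
    (h2 : ∀ k, 1 ≤ k → 2 ≤ CN N₀ t k) {s C : ℝ} (hs0 : 0 ≤ s) (hC : 0 < C)
    (hA : ∀ k, 1 ≤ C * Cδ N₀ (k+2) ^ s * CP N₀ t k) {y y' : ℝ}
    (hy : y ∈ Set.Ico (0:ℝ) 1) (hy' : y' ∈ Set.Ico (0:ℝ) 1) :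
    |y - y'| ≤ C * |Ch N₀ t y - Ch N₀ t y'| ^ s := by
  wlog hyy : y < y' generalizing y y'
  · rcases eq_or_lt_of_le (not_lt.1 hyy) with h | h
    · subst h
      simp only [sub_self, abs_zero]
      positivity
    · rw [abs_sub_comm, abs_sub_comm (Ch N₀ t y)]
      exact this hy' hy h
  obtain ⟨m, h1, h3⟩ := Ch_expand hs h2 hy.1 hyy hy'.2
  have hp := Cδ_pos N₀ (m+2)
  rw [abs_sub_comm, abs_sub_comm (Ch N₀ t y), abs_of_pos (by linarith), abs_of_pos (by linarith)]
  have hP : (0:ℝ) < CP N₀ t m := by exact_mod_cast CP_pos hs h2 m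
  have h4 : (y' - y) ≤ C * Cδ N₀ (m+2) ^ s := by
    refine le_of_mul_le_mul_right (h1.trans (hA m)) hP
  refine h4.trans ?_
  gcongr


lemma ev_bdd (a : ℕ → ℝ) (h : ∀ᶠ k in atTop, a (k+1) ≤ a k) : ∃ C > 0, ∀ k, a k ≤ C := by
  obtain ⟨K, hK⟩ := eventually_atTop.1 h
  refine ⟨1 + ∑ i ∈ Finset.range (K+1), |a i|, by positivity, fun k => ?_⟩
  have small : ∀ k ≤ K, a k ≤ 1 + ∑ i ∈ Finset.range (K+1), |a i| := by
    intro k hk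
    have := Finset.single_le_sum (f := fun i => |a i|) (fun i _ => abs_nonneg _)
      (Finset.mem_range.2 (by omega : k < K+1))
    have := le_abs_self (a k)
    linarith
  rcases le_total k K with hk | hk
  · exact small k hk
  · induction k, hk using Nat.le_induction with
    | base => exact small K le_rfl
    | succ k hk ih => exact (hK k hk).trans ih

lemma ev_rpow (N₀ : ℕ) {a b M : ℝ} (hab : a < b) :
    ∀ᶠ k : ℕ in atTop, M * ((N₀:ℝ) + (k+1:ℕ)) ^ a ≤ ((N₀:ℝ) + (k+1:ℕ)) ^ b := by
  have h1 : Tendsto (fun k : ℕ => (N₀:ℝ) + (k+1:ℕ)) atTop atTop :=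
    tendsto_atTop_add_const_left _ _ (tendsto_natCast_atTop_atTop.comp (tendsto_add_atTop_nat 1))
  have h2 := ((tendsto_rpow_atTop (sub_pos.2 hab)).comp h1).eventually_ge_atTop M
  filter_upwards [h2] with k hk
  have hp : (0:ℝ) < (N₀:ℝ) + (k+1:ℕ) := by positivity
  calc _ ≤ ((N₀:ℝ) + (k+1:ℕ)) ^ (b - a) * ((N₀:ℝ) + (k+1:ℕ)) ^ a := by
        gcongr; exact hk
    _ = _ := by rw [← Real.rpow_add hp]; congr 1; ring


lemma lemA {N₀ : ℕ} {t : ℝ} (hs : ∀ k, 1 ≤ k → CN N₀ t k + 1 ≤ N₀ + k)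
    (h2 : ∀ k, 1 ≤ k → 2 ≤ CN N₀ t k) {s : ℝ} (hs0 : 0 < s) (hst : s < t/2) :
    ∃ C > 0, ∀ k, 1 ≤ C * Cδ N₀ (k+2) ^ s * CP N₀ t k := by
  obtain ⟨C, hC, h⟩ := ev_bdd (fun k => (Cδ N₀ (k+2) ^ s * CP N₀ t k)⁻¹) (by
    filter_upwards [ev_rpow N₀ (M := 3^s) hst] with k hk
    have hP : (0:ℝ) < CP N₀ t k := by exact_mod_cast CP_pos hs h2 k
    have hd := Cδ_pos N₀ (k+2)
    have hd3 := Cδ_pos N₀ (k+3)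
    apply inv_anti₀ (by positivity)
    rw [CP_succ, ← Cδ_succ_mul N₀ (k+2), Real.mul_rpow hd3.le (by positivity)]
    have hN : ((N₀:ℝ) + (k+2+1:ℕ))^s ≤ CN N₀ t (k+1) := by
      calc _ ≤ (3 * ((N₀:ℝ) + (k+1:ℕ)))^s := by
            gcongr; push_cast; nlinarith [(Nat.cast_nonneg k : (0:ℝ) ≤ k), (Nat.cast_nonneg N₀ : (0:ℝ) ≤ N₀)]
        _ = 3^s * ((N₀:ℝ) + (k+1:ℕ))^s := Real.mul_rpow (by norm_num) (by positivity)
        _ ≤ _ := hk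
        _ ≤ _ := Nat.le_ceil _
    push_cast
    push_cast at hN
    calc _ = Cδ N₀ (k+2+1) ^ s * CP N₀ t k * ((N₀:ℝ) + (k+2+1))^s := by ring
      _ ≤ Cδ N₀ (k+2+1) ^ s * CP N₀ t k * CN N₀ t (k+1) := by gcongr
      _ = _ := by rw [show k+1+2 = k+2+1 from rfl]; ring)
  refine ⟨C, hC, fun k => ?_⟩
  have hP : (0:ℝ) < CP N₀ t k := by exact_mod_cast CP_pos hs h2 k
  have hd := Cδ_pos N₀ (k+2)
  have := h k
  rw [inv_le_iff_one_le_mul₀ (by positivity)] at this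
  rw [mul_assoc]; exact this

lemma lemB {N₀ : ℕ} {t : ℝ} (hs : ∀ k, 1 ≤ k → CN N₀ t k + 1 ≤ N₀ + k)
    (h2 : ∀ k, 1 ≤ k → 2 ≤ CN N₀ t k) {s : ℝ} (ht : 0 < t) (hst : t/2 < s) :
    ∃ C > 0, ∀ k, CP N₀ t (k+1) * Cδ N₀ k ^ s ≤ C := by
  refine ev_bdd _ ?_
  filter_upwards [ev_rpow N₀ (M := 2 * 2^(t/2)) hst] with k hk
  have hP : (0:ℝ) < CP N₀ t (k+1) := by exact_mod_cast CP_pos hs h2 (k+1)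
  have hd := Cδ_pos N₀ (k+1)
  rw [CP_succ _ _ (k+1), ← Cδ_succ_mul N₀ k, Real.mul_rpow hd.le (by positivity)]
  have hN : (CN N₀ t (k+1+1):ℝ) ≤ ((N₀:ℝ) + (k+1:ℕ))^s := by
    have h1 : (1:ℝ) ≤ ((N₀:ℝ) + (k+1+1:ℕ))^(t/2) := by
      apply Real.one_le_rpow _ (by positivity)
      push_cast; nlinarith [(Nat.cast_nonneg k : (0:ℝ) ≤ k), (Nat.cast_nonneg N₀ : (0:ℝ) ≤ N₀)]
    calc _ ≤ ((N₀:ℝ) + (k+1+1:ℕ))^(t/2) + 1 := (Nat.ceil_lt_add_one (by positivity)).le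
      _ ≤ 2 * ((N₀:ℝ) + (k+1+1:ℕ))^(t/2) := by linarith
      _ ≤ 2 * (2 * ((N₀:ℝ) + (k+1:ℕ)))^(t/2) := by
          gcongr; push_cast; nlinarith [(Nat.cast_nonneg k : (0:ℝ) ≤ k), (Nat.cast_nonneg N₀ : (0:ℝ) ≤ N₀)]
      _ = 2 * 2^(t/2) * ((N₀:ℝ) + (k+1:ℕ))^(t/2) := by
          rw [Real.mul_rpow (by norm_num) (by positivity)]; ring
      _ ≤ _ := hk
  push_cast at *
  calc _ = CP N₀ t (k+1) * Cδ N₀ (k+1) ^ s * CN N₀ t (k+1+1) := by ring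
    _ ≤ CP N₀ t (k+1) * Cδ N₀ (k+1) ^ s * ((N₀:ℝ) + (k+1))^s := by gcongr
    _ = _ := by ring

lemma CF_cover {N₀ : ℕ} {t : ℝ} (k : ℕ) : ∃ U : Fin (CP N₀ t k) → Set ℝ,
    (∀ i, Metric.ediam (U i) ≤ ENNReal.ofReal (Cδ N₀ k)) ∧ CF N₀ t ⊆ ⋃ i, U i := by
  have hc : Fintype.card (∀ i : Finset.Icc 1 k, Fin (CN N₀ t i)) = CP N₀ t k := by
    rw [Fintype.card_pi]
    simp only [Fintype.card_fin]
    exact Finset.prod_coe_sort (Finset.Icc 1 k) (CN N₀ t)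
  let e := (Fintype.equivFinOfCardEq hc)
  let A : (∀ i : Finset.Icc 1 k, Fin (CN N₀ t i)) → ℝ := fun f => ∑ i : Finset.Icc 1 k, Cδ N₀ i * ((f i : ℕ) : ℝ)
  refine ⟨fun j => Set.Icc (A (e.symm j)) (A (e.symm j) + Cδ N₀ k), fun i => ?_, fun x hx => ?_⟩
  · rw [Real.ediam_Icc]; simp
  · obtain ⟨f, hf, r, hr, rfl⟩ := Set.mem_iInter.1 hx k
    refine Set.mem_iUnion.2 ⟨e fun i => ⟨f i, hf i i.2⟩, ?_⟩
    have : A (fun i => ⟨f i, hf i i.2⟩) = ∑ i ∈ Finset.Icc 1 k, Cδ N₀ i * f i :=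
      Finset.sum_coe_sort (Finset.Icc 1 k) (fun i => Cδ N₀ i * (f i:ℝ))
    simp only [Equiv.symm_apply_apply, this]
    constructor <;> linarith [hr.1, hr.2]

lemma dimH_upper {N₀ : ℕ} {t : ℝ} (hs : ∀ k, 1 ≤ k → CN N₀ t k + 1 ≤ N₀ + k)
    (h2 : ∀ k, 1 ≤ k → 2 ≤ CN N₀ t k) {s : ℝ} (ht : 0 < t) (hst : t/2 < s) : dimH (CF N₀ t) ≤ ENNReal.ofReal s := by
  obtain ⟨C, hC, hB⟩ := lemB hs h2 ht hst
  choose U hU hcov using CF_cover (N₀ := N₀) (t := t)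
  have hs0 : 0 ≤ s := by linarith
  apply dimH_le_of_hausdorffMeasure_ne_top
  rw [Real.coe_toNNReal _ hs0]
  have := Measure.hausdorffMeasure_le_liminf_sum s (CF N₀ t) (l := atTop)
    (fun k => ENNReal.ofReal (Cδ N₀ (k+1)))
    (by simpa using ENNReal.tendsto_ofReal ((Cδ_tendsto hs h2).comp (tendsto_add_atTop_nat 1)))
    (fun k => U (k+1)) (.of_forall fun k => hU (k+1)) (.of_forall fun k => hcov (k+1))
  refine ne_top_of_le_ne_top (ENNReal.ofReal_ne_top (r := C)) (this.trans ?_)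
  refine liminf_le_of_le (by isBoundedDefault) fun b hb => ?_
  obtain ⟨k, hk⟩ := hb.exists
  refine hk.trans ?_
  calc _ ≤ ∑ i : Fin (CP N₀ t (k+1)), ENNReal.ofReal (Cδ N₀ (k+1)) ^ s := by
        gcongr; exact hU _ _
    _ = ENNReal.ofReal (CP N₀ t (k+1) * Cδ N₀ (k+1) ^ s) := by
        simp only [Finset.sum_const, Finset.card_univ, Fintype.card_fin, nsmul_eq_mul]
        rw [ENNReal.ofReal_mul (by positivity), ENNReal.ofReal_natCast,
          ENNReal.ofReal_rpow_of_pos (Cδ_pos _ _)]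
    _ ≤ _ := by
        apply ENNReal.ofReal_le_ofReal
        refine le_trans ?_ (hB k)
        have := Cδ_pos N₀ (k+1)
        gcongr
        exact Cδ_anti hs h2 (by omega)

lemma dimH_lower {N₀ : ℕ} {t : ℝ} (hs : ∀ k, 1 ≤ k → CN N₀ t k + 1 ≤ N₀ + k)
    (h2 : ∀ k, 1 ≤ k → 2 ≤ CN N₀ t k) {s : ℝ} (hs0 : 0 < s) (hst : s < t/2) : ENNReal.ofReal s ≤ dimH (CF N₀ t) := by
  obtain ⟨C, hC, hA⟩ := lemA hs h2 hs0 hst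
  have hh := fun {y y'} => Ch_holder hs h2 hs0.le hC hA (y := y) (y' := y')
  have inj : Set.InjOn (Ch N₀ t) (Set.Ico 0 1) := by
    intro y hy y' hy' h
    have := hh hy hy'
    rw [h, sub_self, abs_zero, Real.zero_rpow hs0.ne', mul_zero] at this
    linarith [abs_nonpos_iff.1 this]
  have hG := inj.leftInvOn_invFunOn
  set G := Function.invFunOn (Ch N₀ t) (Set.Ico 0 1)
  have hol : HolderOnWith C.toNNReal s.toNNReal G (Ch N₀ t '' Set.Ico 0 1) := by
    rintro _ ⟨y, hy, rfl⟩ _ ⟨y', hy', rfl⟩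
    rw [hG hy, hG hy', edist_dist, edist_dist, Real.dist_eq, Real.dist_eq,
      Real.coe_toNNReal _ hs0.le, ENNReal.ofReal_rpow_of_nonneg (abs_nonneg _) hs0.le]
    change _ ≤ ENNReal.ofReal C * _
    rw [← ENNReal.ofReal_mul hC.le]
    exact ENNReal.ofReal_le_ofReal (hh hy hy')
  have := hol.dimH_image_le (by simpa using hs0)
  rw [hG.image_image, Real.dimH_of_nonempty_interior (by simp)] at this
  simp only [Module.finrank_self, Nat.cast_one] at this
  have h3 : dimH (Ch N₀ t '' Set.Ico 0 1) ≤ dimH (CF N₀ t) := dimH_mono (by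
    rintro _ ⟨y, _, rfl⟩; exact Ch_mem_CF hs h2 y)
  refine le_trans ?_ h3
  change 1 ≤ _ / ENNReal.ofReal s at this
  have h0 : ENNReal.ofReal s ≠ 0 := by simpa using hs0
  rwa [ENNReal.le_div_iff_mul_le (Or.inl h0) (Or.inl ENNReal.ofReal_ne_top), one_mul] at this

lemma coverN_le {N₀ : ℕ} {t : ℝ} {δ : ℝ} {k : ℕ} (h : Cδ N₀ k ≤ δ) : coverN (CF N₀ t) δ ≤ CP N₀ t k := by
  obtain ⟨U, hU, hc⟩ := CF_cover (N₀ := N₀) (t := t) k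
  exact Nat.sInf_le ⟨U, fun i => (hU i).trans (ENNReal.ofReal_le_ofReal h), hc⟩

lemma coverN_upper {N₀ : ℕ} {t : ℝ} (hs : ∀ k, 1 ≤ k → CN N₀ t k + 1 ≤ N₀ + k)
    (h2 : ∀ k, 1 ≤ k → 2 ≤ CN N₀ t k) {s C : ℝ} (hs0 : 0 ≤ s)
    (hB : ∀ k, CP N₀ t (k+1) * Cδ N₀ k ^ s ≤ C) {δ : ℝ} (h0 : 0 < δ) (h1 : δ < 1) :
    coverN (CF N₀ t) δ * δ ^ s ≤ C := by
  classical
  have hex : ∃ k, Cδ N₀ k ≤ δ := ((Cδ_tendsto hs h2).eventually (ge_mem_nhds h0)).exists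
  obtain ⟨m, hm⟩ : ∃ m, Nat.find hex = m + 1 := by
    refine Nat.exists_eq_succ_of_ne_zero fun h => ?_
    have := Nat.find_spec hex
    rw [h, Cδ_zero] at this
    linarith
  have ha := Nat.find_spec hex
  have hb : δ < Cδ N₀ m := not_le.1 (Nat.find_min hex (by omega : m < Nat.find hex))
  rw [hm] at ha
  refine le_trans ?_ (hB m)
  have : (coverN (CF N₀ t) δ : ℝ) ≤ CP N₀ t (m+1) := by exact_mod_cast coverN_le ha
  gcongr

lemma coverN_lower {N₀ : ℕ} {t : ℝ} (hs : ∀ k, 1 ≤ k → CN N₀ t k + 1 ≤ N₀ + k)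
    (h2 : ∀ k, 1 ≤ k → 2 ≤ CN N₀ t k) {s C : ℝ} (hs0 : 0 < s) (hC : 0 < C)
    (hA : ∀ k, 1 ≤ C * Cδ N₀ (k+2) ^ s * CP N₀ t k) {δ : ℝ} (h0 : 0 < δ) :
    1 ≤ coverN (CF N₀ t) δ * (C * δ ^ s) := by
  have hne : {n : ℕ | ∃ U : Fin n → Set ℝ,
      (∀ i, Metric.ediam (U i) ≤ ENNReal.ofReal δ) ∧ CF N₀ t ⊆ ⋃ i, U i}.Nonempty := by
    obtain ⟨k, hk⟩ := ((Cδ_tendsto hs h2).eventually (ge_mem_nhds h0)).exists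
    obtain ⟨U, hU, hc⟩ := CF_cover (N₀ := N₀) (t := t) k
    exact ⟨_, U, fun i => (hU i).trans (ENNReal.ofReal_le_ofReal hk), hc⟩
  obtain ⟨U, hU, hc⟩ : coverN (CF N₀ t) δ ∈ {n : ℕ | ∃ U : Fin n → Set ℝ,
      (∀ i, Metric.ediam (U i) ≤ ENNReal.ofReal δ) ∧ CF N₀ t ⊆ ⋃ i, U i} := Nat.sInf_mem hne
  have hsub : Set.Ico (0:ℝ) 1 ⊆ ⋃ i, (Set.Ico (0:ℝ) 1 ∩ Ch N₀ t ⁻¹' U i) := by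
    intro y hy
    obtain ⟨i, hi⟩ := Set.mem_iUnion.1 (hc (Ch_mem_CF hs h2 y))
    exact Set.mem_iUnion.2 ⟨i, hy, hi⟩
  have hvol := (measure_mono hsub).trans (measure_iUnion_le (μ := volume) _)
  rw [Real.volume_Ico, tsum_fintype] at hvol
  have hd : ∀ i, volume (Set.Ico (0:ℝ) 1 ∩ Ch N₀ t ⁻¹' U i) ≤ ENNReal.ofReal (C * δ ^ s) := by
    intro i
    refine (Real.volume_le_diam _).trans (Metric.ediam_le ?_)
    rintro y ⟨hy, hyU⟩ y' ⟨hy', hyU'⟩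
    rw [edist_dist, Real.dist_eq]
    apply ENNReal.ofReal_le_ofReal
    refine (Ch_holder hs h2 hs0.le hC hA hy hy').trans ?_
    have := (Metric.edist_le_ediam_of_mem (s := U i) hyU hyU').trans (hU i)
    rw [edist_dist, Real.dist_eq, ENNReal.ofReal_le_ofReal_iff h0.le] at this
    gcongr
  have := hvol.trans (Finset.sum_le_sum fun i _ => hd i)
  simp only [Finset.sum_const, Finset.card_univ, Fintype.card_fin, nsmul_eq_mul] at this
  rw [← ENNReal.ofReal_natCast, ← ENNReal.ofReal_mul (by positivity),
    ENNReal.ofReal_le_ofReal_iff (by positivity)] at this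
  linarith

lemma box_tendsto {N₀ : ℕ} {t : ℝ} (hs : ∀ k, 1 ≤ k → CN N₀ t k + 1 ≤ N₀ + k)
    (h2 : ∀ k, 1 ≤ k → 2 ≤ CN N₀ t k) (ht : 0 < t) : Tendsto (fun δ : ℝ => Real.log (coverN (CF N₀ t) δ) / -Real.log δ)
    (nhdsWithin 0 (Set.Ioi 0)) (nhds (t/2)) := by
  have hlog : Tendsto (fun δ : ℝ => -Real.log δ) (nhdsWithin 0 (Set.Ioi 0)) atTop :=
    tendsto_neg_atBot_atTop.comp Real.tendsto_log_nhdsGT_zero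
  have hmem : ∀ᶠ δ : ℝ in nhdsWithin 0 (Set.Ioi 0), δ ∈ Set.Ioo (0:ℝ) 1 :=
    Ioo_mem_nhdsGT one_pos
  have hpos : ∀ δ : ℝ, 0 < δ → (0:ℝ) < coverN (CF N₀ t) δ := by
    intro δ hδ
    obtain ⟨C, hC, hA⟩ := lemA hs h2 (s := t/4) (by linarith) (by linarith)
    have := coverN_lower hs h2 (by linarith) hC hA hδ
    by_contra h
    have h' : (coverN (CF N₀ t) δ : ℝ) = 0 := le_antisymm (not_lt.1 h) (by positivity)
    rw [h', zero_mul] at this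
    linarith
  rw [tendsto_order]
  constructor
  · intro a ha
    obtain ⟨s, hs1, hs3⟩ := exists_between (max_lt ha (by linarith : 0 < t/2))
    have hs0 : 0 < s := (le_max_right _ _).trans_lt hs1
    have hsa : a < s := (le_max_left _ _).trans_lt hs1
    obtain ⟨C, hC, hA⟩ := lemA hs h2 hs0 hs3
    filter_upwards [hmem, hlog.eventually_gt_atTop (Real.log C / (s - a)),
      hlog.eventually_gt_atTop 0] with δ hδ hl hl0
    have h1 := Real.log_le_log one_pos (coverN_lower hs h2 hs0 hC hA hδ.1)
    have hp := hpos δ hδ.1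
    have hδs := Real.rpow_pos_of_pos hδ.1 s
    rw [Real.log_one, Real.log_mul hp.ne' (by positivity), Real.log_mul hC.ne' hδs.ne',
      Real.log_rpow hδ.1] at h1
    rw [div_lt_iff₀ (by linarith)] at hl
    rw [lt_div_iff₀ hl0]
    linarith
  · intro a ha
    obtain ⟨s, hs1, hs3⟩ := exists_between ha
    obtain ⟨C, hC, hB⟩ := lemB hs h2 ht hs1
    filter_upwards [hmem, hlog.eventually_gt_atTop (Real.log C / (a - s)),
      hlog.eventually_gt_atTop 0] with δ hδ hl hl0
    have hp := hpos δ hδ.1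
    have hδs := Real.rpow_pos_of_pos hδ.1 s
    have h1 := Real.log_le_log (by positivity) (coverN_upper hs h2 (by linarith) hB hδ.1 hδ.2)
    rw [Real.log_mul hp.ne' hδs.ne', Real.log_rpow hδ.1] at h1
    rw [div_lt_iff₀ (by linarith)] at hl
    rw [div_lt_iff₀ hl0]
    linarith


/-- The Cantor set `F` has Hausdorff and (upper and lower) box dimension `t/2`. -/
theorem stmt14 (t : ℝ) (ht : 0 < t) (ht2 : t < 2) (N₀ : ℕ)
    (hsmall : ∀ k : ℕ, 1 ≤ k → ((N₀ : ℝ) + k)⁻¹ * CN N₀ t k < 1) :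
    dimH (CF N₀ t) = ENNReal.ofReal (t / 2) ∧
    lowerBoxDim (CF N₀ t) = t / 2 ∧ upperBoxDim (CF N₀ t) = t / 2 := by
  have hs : ∀ k, 1 ≤ k → CN N₀ t k + 1 ≤ N₀ + k := by
    intro k hk
    have h := hsmall k hk
    have hp : (0:ℝ) < (N₀:ℝ) + k := by
      have : (1:ℝ) ≤ k := by exact_mod_cast hk
      positivity
    rw [inv_mul_lt_iff₀ hp, mul_one] at h
    exact_mod_cast h
  have h2 : ∀ k, 1 ≤ k → 2 ≤ CN N₀ t k := by
    intro k hk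
    have h1 : 1 ≤ CN N₀ t k := by
      apply Nat.one_le_iff_ne_zero.2
      have : (0:ℝ) < (k:ℝ) := by exact_mod_cast hk
      exact (Nat.ceil_pos.2 (by positivity)).ne'
    have h3 := hs k hk
    have h4 : (1:ℝ) < (N₀:ℝ) + k := by exact_mod_cast (by omega : 1 < N₀ + k)
    have : 1 < CN N₀ t k := Nat.lt_ceil.2 (by
      rw [Nat.cast_one]; exact Real.one_lt_rpow h4 (by linarith))
    exact this
  have hbox := box_tendsto hs h2 ht
  refine ⟨le_antisymm ?_ ?_, hbox.liminf_eq, hbox.limsup_eq⟩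
  · refine le_of_forall_gt fun b hb => ?_
    obtain ⟨c, hc1, hc2⟩ := exists_between hb
    have hct : c ≠ ⊤ := (hc2.trans_le le_top).ne
    rw [ENNReal.ofReal_lt_iff_lt_toReal (by linarith) hct] at hc1
    have := dimH_upper hs h2 ht hc1
    rw [ENNReal.ofReal_toReal hct] at this
    exact this.trans_lt hc2
  · refine le_of_forall_lt fun b hb => ?_
    obtain ⟨c, hc1, hc2⟩ := exists_between hb
    have hct : c ≠ ⊤ := (hc2.trans_le le_top).ne
    have hc0 : 0 < c := bot_le.trans_lt hc1
    rw [ENNReal.lt_ofReal_iff_toReal_lt hct] at hc2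
    have := dimH_lower hs h2 (ENNReal.toReal_pos hc0.ne' hct) hc2
    rw [ENNReal.ofReal_toReal hct] at this
    exact hc1.trans_le this
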